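/- arXiv:1304.3833 — 3 statements merged into one kernel-verified Lean document; each statement's English description precedes it below -/
import Mathlib

section
/- Let k and n be integers with k ≥ 2 and n ≥ 1. Then −2n + ⌈n/2⌉ + ⌈2n/3⌉ + ⌈n(5k−1)/(6k−1)⌉ = 2, where ⌈·⌉ denotes the ceiling of the indicated rational number, holds if and only if there exists an integer l with 1 ≤ l ≤ k−1 and n = 6l−1. -/
/-- The arithmetic characterization of solutions of Massot's necessary condition
`-2n + ⌈n/2⌉ + ⌈2n/3⌉ + ⌈n(5k-1)/(6k-1)⌉ = 2` for the Brieskorn manifold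
`-Σ(2,3,6k-1)`: the solutions are exactly `n = 6l - 1` with `1 ≤ l ≤ k - 1`. -/
theorem massot_condition_iff (k n : ℤ) (hk : 2 ≤ k) (hn : 1 ≤ n) :
    (-2 * n + ⌈(n : ℚ) / 2⌉ + ⌈(2 * (n : ℚ)) / 3⌉ +
        ⌈((n : ℚ) * (5 * (k : ℚ) - 1)) / (6 * (k : ℚ) - 1)⌉ = 2) ↔
      ∃ l : ℤ, 1 ≤ l ∧ l ≤ k - 1 ∧ n = 6 * l - 1 := by
  have hM : (0 : ℚ) < 6 * (k : ℚ) - 1 := by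
    have : (2 : ℚ) ≤ k := by exact_mod_cast hk
    linarith
  have ha : ⌈(n : ℚ) / 2⌉ = (n + 1) / 2 := by
    rw [Int.ceil_eq_iff]
    have h1 : 2 * ((n + 1) / 2) - 2 < n := by omega
    have h2 : n ≤ 2 * ((n + 1) / 2) := by omega
    generalize (n + 1) / 2 = a at h1 h2
    have h1' : 2 * (a : ℚ) - 2 < n := by exact_mod_cast h1
    have h2' : (n : ℚ) ≤ 2 * a := by exact_mod_cast h2
    constructor <;> linarith
  have hb : ⌈(2 * (n : ℚ)) / 3⌉ = (2 * n + 2) / 3 := by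
    rw [Int.ceil_eq_iff]
    have h1 : 3 * ((2 * n + 2) / 3) - 3 < 2 * n := by omega
    have h2 : 2 * n ≤ 3 * ((2 * n + 2) / 3) := by omega
    generalize (2 * n + 2) / 3 = a at h1 h2
    have h1' : 3 * (a : ℚ) - 3 < 2 * n := by exact_mod_cast h1
    have h2' : 2 * (n : ℚ) ≤ 3 * a := by exact_mod_cast h2
    constructor <;> linarith
  have hc : ∀ c : ℤ, ⌈((n : ℚ) * (5 * (k : ℚ) - 1)) / (6 * (k : ℚ) - 1)⌉ = c ↔
      (c - 1) * (6 * k - 1) < n * (5 * k - 1) ∧ n * (5 * k - 1) ≤ c * (6 * k - 1) := by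
    intro c
    rw [Int.ceil_eq_iff, lt_div_iff₀ hM, div_le_iff₀ hM]
    exact_mod_cast Iff.rfl
  rw [ha, hb]
  constructor
  · intro h
    obtain ⟨h1, -⟩ := (hc (2 + 2 * n - (n + 1) / 2 - (2 * n + 2) / 3)).1 (by linarith)
    generalize hcc : 2 + 2 * n - (n + 1) / 2 - (2 * n + 2) / 3 = c at h1
    have h3 : n < (6 * k - 1) * (5 * n - 6 * (c - 1)) := by linarith
    have h4 : 0 < 5 * n - 6 * (c - 1) := by
      by_contra h5
      have : (6 * k - 1) * (5 * n - 6 * (c - 1)) ≤ 0 :=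
        mul_nonpos_of_nonneg_of_nonpos (by linarith) (by linarith)
      linarith
    have h5 : 5 * n - 6 * (c - 1) = 1 ∧ n % 6 = 5 := by
      clear h1 h3 h
      have hr : n % 6 = 0 ∨ n % 6 = 1 ∨ n % 6 = 2 ∨ n % 6 = 3 ∨ n % 6 = 4 ∨ n % 6 = 5 := by
        omega
      rcases hr with hr | hr | hr | hr | hr | hr <;> omega
    rw [h5.1] at h3
    exact ⟨(n + 1) / 6, by omega, by omega, by omega⟩
  · rintro ⟨l, hl1, hl2, rfl⟩
    have h := (hc (5 * l)).2 ⟨by linarith, by linarith⟩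
    rw [h]
    omega
end

section
/- (Kopell's Lemma.) Let f, g : ℝ → ℝ be functions mapping the half-open interval [0,1) into itself with f(0) = 0 and g(0) = 0. Assume that f is of class C² on [0,1) with strictly positive derivative at every point of [0,1), that g is of class C¹ on [0,1) with strictly positive derivative at every point of [0,1), that f and g commute on [0,1) (that is, f(g(x)) = g(f(x)) for all x ∈ [0,1)), and that f is contracting, i.e. f(x) < x for every x ∈ (0,1). Then either g has no fixed point in (0,1) (g(x) ≠ x for all x ∈ (0,1)), or g is the identity on [0,1) (g(x) = x for all x ∈ [0,1)). -/
open Set Filter Topology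

/-- Mean value theorem on `[0,1)` in terms of `derivWithin`. -/
lemma kop_mvt (f : ℝ → ℝ) (hf : ContDiffOn ℝ 1 f (Ico (0 : ℝ) 1)) {u v : ℝ}
    (hu : 0 ≤ u) (huv : u < v) (hv : v < 1) :
    ∃ ξ ∈ Ioo u v, f v - f u = derivWithin f (Ico (0 : ℝ) 1) ξ * (v - u) := by
  have hd := hf.differentiableOn (by norm_num)
  obtain ⟨ξ, hξ, h⟩ := exists_hasDerivAt_eq_slope f (derivWithin f (Ico (0 : ℝ) 1)) huv
    (hf.continuousOn.mono (fun y hy => ⟨hu.trans hy.1, hy.2.trans_lt hv⟩))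
    (fun x hx => by
      have hx' : x ∈ Ico (0 : ℝ) 1 := ⟨hu.trans hx.1.le, hx.2.trans hv⟩
      exact (hd x hx').hasDerivWithinAt.hasDerivAt
        (Ico_mem_nhds (hu.trans_lt hx.1) hx'.2))
  refine ⟨ξ, hξ, ?_⟩
  rw [h]
  have : v - u ≠ 0 := by linarith
  field_simp

lemma kop_mono (f : ℝ → ℝ) (hf : ContDiffOn ℝ 1 f (Ico (0 : ℝ) 1))
    (hd : ∀ x ∈ Ico (0 : ℝ) 1, 0 < derivWithin f (Ico (0 : ℝ) 1) x) :
    StrictMonoOn f (Ico (0 : ℝ) 1) := by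
  intro u hu v hv huv
  obtain ⟨ξ, hξ, h⟩ := kop_mvt f hf hu.1 huv hv.2
  have := mul_pos (hd ξ ⟨hu.1.trans hξ.1.le, hξ.2.trans hv.2⟩) (sub_pos.2 huv)
  linarith

/-- Orbits of a contraction tend to `0`. -/
lemma kop_orbit (f : ℝ → ℝ) (hm : MapsTo f (Ico (0 : ℝ) 1) (Ico (0 : ℝ) 1)) (hf0 : f 0 = 0)
    (hc : ContinuousOn f (Ico (0 : ℝ) 1)) (hcontract : ∀ x ∈ Ioo (0 : ℝ) 1, f x < x)
    {x : ℝ} (hx : x ∈ Ico (0 : ℝ) 1) : Tendsto (fun n => f^[n] x) atTop (𝓝 0) := by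
  have hmem : ∀ n, f^[n] x ∈ Ico (0 : ℝ) 1 := fun n => hm.iterate n hx
  have hle : ∀ y ∈ Ico (0 : ℝ) 1, f y ≤ y := by
    intro y hy
    rcases hy.1.eq_or_lt with h | h
    · rw [← h, hf0]
    · exact (hcontract y ⟨h, hy.2⟩).le
  have hanti : Antitone (fun n => f^[n] x) := antitone_nat_of_succ_le (fun n => by
    rw [Function.iterate_succ_apply']; exact hle _ (hmem n))
  have hlim := tendsto_atTop_ciInf hanti ⟨0, by rintro _ ⟨n, rfl⟩; exact (hmem n).1⟩
  set l := ⨅ n, f^[n] x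
  have hl0 : 0 ≤ l := ge_of_tendsto' hlim (fun n => (hmem n).1)
  have hlx : l ≤ x := le_of_tendsto' hlim (fun n => hanti (Nat.zero_le n))
  have hlI : l ∈ Ico (0 : ℝ) 1 := ⟨hl0, hlx.trans_lt hx.2⟩
  have h1 : Tendsto (fun n => f (f^[n] x)) atTop (𝓝 (f l)) :=
    (hc l hlI).tendsto.comp
      (tendsto_nhdsWithin_iff.2 ⟨hlim, Eventually.of_forall hmem⟩)
  have h2 : Tendsto (fun n => f (f^[n] x)) atTop (𝓝 l) := by
    have := (tendsto_add_atTop_iff_nat 1).2 hlim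
    simpa only [Function.iterate_succ_apply'] using this
  have h3 := tendsto_nhds_unique h1 h2
  rcases hl0.eq_or_lt with h | h
  · rw [h]; exact hlim
  · exact absurd h3 (hcontract l ⟨h, hlI.2⟩).ne

lemma kop_one_step (f : ℝ → ℝ) (hf : ContDiffOn ℝ 2 f (Ico (0 : ℝ) 1))
    (hd : ∀ x ∈ Ico (0 : ℝ) 1, 0 < derivWithin f (Ico (0 : ℝ) 1) x) {p : ℝ}
    (hp : p ∈ Ioo (0 : ℝ) 1) :
    ∃ L : ℝ, 0 ≤ L ∧ ∀ a b : ℝ, 0 ≤ a → b ≤ p → ∀ u v u' v' : ℝ,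
      u ∈ Icc a b → v ∈ Icc a b → u' ∈ Icc a b → v' ∈ Icc a b → u < v → u' < v' →
      (f v - f u) * (v' - u') ≤ Real.exp (L * (b - a)) * ((f v' - f u') * (v - u)) := by
  set F := derivWithin f (Ico (0 : ℝ) 1) with hF
  have hsub : Icc (0 : ℝ) p ⊆ Ico (0 : ℝ) 1 := fun y hy => ⟨hy.1, hy.2.trans_lt hp.2⟩
  have hf1 : ContDiffOn ℝ 1 f (Ico (0 : ℝ) 1) := hf.of_le (by norm_num)
  have hFC : ContDiffOn ℝ 1 F (Ico (0 : ℝ) 1) :=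
    hf.derivWithin (uniqueDiffOn_Ico 0 1) (by norm_num)
  have hne : (Icc (0 : ℝ) p).Nonempty := ⟨0, le_rfl, hp.1.le⟩
  obtain ⟨z, hz, hzmin⟩ := isCompact_Icc.exists_isMinOn hne (hFC.continuousOn.mono hsub)
  have hm : 0 < F z := hd z (hsub hz)
  have hFd : ContinuousOn (derivWithin F (Ico (0 : ℝ) 1)) (Icc 0 p) :=
    (hFC.continuousOn_derivWithin (uniqueDiffOn_Ico 0 1) (by norm_num)).mono hsub
  obtain ⟨K, hK⟩ := isCompact_Icc.exists_bound_of_continuousOn hFd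
  have hK0 : 0 ≤ K := (norm_nonneg _).trans (hK z hz)
  have hLip : ∀ s ∈ Icc (0 : ℝ) p, ∀ t ∈ Icc (0 : ℝ) p, s < t → |F t - F s| ≤ K * (t - s) := by
    intro s hs t ht hst
    obtain ⟨ξ, hξ, h⟩ := kop_mvt F hFC hs.1 hst (hsub ht).2
    rw [h, abs_mul, abs_of_pos (sub_pos.2 hst)]
    exact mul_le_mul_of_nonneg_right (hK ξ ⟨hs.1.trans hξ.1.le, hξ.2.le.trans ht.2⟩)
      (sub_pos.2 hst).le
  refine ⟨K / F z, by positivity, ?_⟩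
  intro a b ha hb u v u' v' hu hv hu' hv' huv huv'
  obtain ⟨ξ, hξ, h⟩ := kop_mvt f hf1 (ha.trans hu.1) huv ((hv.2.trans hb).trans_lt hp.2)
  obtain ⟨η, hη, h'⟩ := kop_mvt f hf1 (ha.trans hu'.1) huv' ((hv'.2.trans hb).trans_lt hp.2)
  have hξ1 : a ≤ ξ := hu.1.trans hξ.1.le
  have hξ2 : ξ ≤ b := hξ.2.le.trans hv.2
  have hη1 : a ≤ η := hu'.1.trans hη.1.le
  have hη2 : η ≤ b := hη.2.le.trans hv'.2
  have hξp : ξ ∈ Icc (0 : ℝ) p := ⟨ha.trans hξ1, hξ2.trans hb⟩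
  have hηp : η ∈ Icc (0 : ℝ) p := ⟨ha.trans hη1, hη2.trans hb⟩
  have hdiff : F ξ - F η ≤ K * (b - a) := by
    have hab : 0 ≤ b - a := by linarith
    rcases lt_trichotomy ξ η with hlt | heq | hlt
    · have := (neg_abs_le (F η - F ξ))
      have h3 := hLip ξ hξp η hηp hlt
      have h4 : K * (η - ξ) ≤ K * (b - a) := mul_le_mul_of_nonneg_left (by linarith) hK0
      linarith
    · rw [heq]; have := mul_nonneg hK0 hab; linarith
    · have := (le_abs_self (F ξ - F η))
      have h3 := hLip η hηp ξ hξp hlt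
      have h4 : K * (ξ - η) ≤ K * (b - a) := mul_le_mul_of_nonneg_left (by linarith) hK0
      linarith
  have hmη : F z ≤ F η := hzmin hηp
  have key : F ξ ≤ Real.exp (K / F z * (b - a)) * F η := by
    have h1 := Real.add_one_le_exp (K / F z * (b - a))
    have h2 : K * (b - a) ≤ K / F z * (b - a) * F η := by
      have : K * (b - a) = K / F z * (b - a) * F z := by field_simp
      rw [this]
      refine mul_le_mul_of_nonneg_left hmη ?_
      have : 0 ≤ b - a := by linarith
      positivity
    have h3 := mul_le_mul_of_nonneg_right h1 (hm.le.trans hmη)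
    linarith
  rw [h, h']
  have hpos : 0 ≤ (v - u) * (v' - u') := mul_nonneg (by linarith) (by linarith)
  have := mul_le_mul_of_nonneg_right key hpos
  linarith

/-- Bounded distortion of the iterates on a fundamental domain. -/
lemma kop_distortion (f : ℝ → ℝ) (hm : MapsTo f (Ico (0 : ℝ) 1) (Ico (0 : ℝ) 1))
    (hf : ContDiffOn ℝ 2 f (Ico (0 : ℝ) 1))
    (hd : ∀ x ∈ Ico (0 : ℝ) 1, 0 < derivWithin f (Ico (0 : ℝ) 1) x)
    (hcontract : ∀ x ∈ Ioo (0 : ℝ) 1, f x < x) {p : ℝ}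
    (hp : p ∈ Ioo (0 : ℝ) 1) :
    ∃ C : ℝ, 0 < C ∧ ∀ n : ℕ, ∀ u v u' v' : ℝ,
      u ∈ Icc (f p) p → v ∈ Icc (f p) p → u' ∈ Icc (f p) p → v' ∈ Icc (f p) p →
      u < v → u' < v' →
      (f^[n] v - f^[n] u) * (v' - u') ≤ C * ((f^[n] v' - f^[n] u') * (v - u)) := by
  obtain ⟨L, hL0, hL⟩ := kop_one_step f hf hd hp
  have hmono := kop_mono f (hf.of_le (by norm_num)) hd
  have hpI : p ∈ Ico (0 : ℝ) 1 := ⟨hp.1.le, hp.2⟩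
  have hpn : ∀ n, f^[n] p ∈ Ico (0 : ℝ) 1 := fun n => hm.iterate n hpI
  have hsub : Icc (f p) p ⊆ Ico (0 : ℝ) 1 :=
    fun y hy => ⟨(hm hpI).1.trans hy.1, hy.2.trans_lt hp.2⟩
  have hit : ∀ n, StrictMonoOn f^[n] (Ico (0 : ℝ) 1) := by
    intro n
    induction n with
    | zero => exact strictMonoOn_id
    | succ n ih =>
      rw [Function.iterate_succ]
      exact ih.comp hmono hm
  have hmem : ∀ n, ∀ u ∈ Icc (f p) p, f^[n] u ∈ Icc (f^[n + 1] p) (f^[n] p) := by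
    intro n u hu
    rw [Function.iterate_succ_apply]
    exact ⟨(hit n).monotoneOn (hm hpI) (hsub hu) hu.1, (hit n).monotoneOn (hsub hu) hpI hu.2⟩
  have hlep : ∀ n, f^[n] p ≤ p := by
    intro n
    have hfp : f p ≤ p := (hcontract p hp).le
    induction n with
    | zero => exact le_rfl
    | succ n ih =>
      have := hmem n p ⟨hfp, le_rfl⟩
      exact (this.1.trans this.2).trans ih
  have main : ∀ n : ℕ, ∀ u v u' v' : ℝ,
      u ∈ Icc (f p) p → v ∈ Icc (f p) p → u' ∈ Icc (f p) p → v' ∈ Icc (f p) p →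
      u < v → u' < v' →
      (f^[n] v - f^[n] u) * (v' - u') ≤
        Real.exp (L * (p - f^[n] p)) * ((f^[n] v' - f^[n] u') * (v - u)) := by
    intro n
    induction n with
    | zero =>
      intro u v u' v' _ _ _ _ _ _
      simp [mul_comm]
    | succ n ih =>
      intro u v u' v' hu hv hu' hv' huv huv'
      have h1 := ih u v u' v' hu hv hu' hv' huv huv'
      have hA : f^[n] u < f^[n] v := hit n (hsub hu) (hsub hv) huv
      have hA' : f^[n] u' < f^[n] v' := hit n (hsub hu') (hsub hv') huv'
      have h2 := hL (f^[n + 1] p) (f^[n] p) (hpn _).1 (hlep n) _ _ _ _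
        (hmem n u hu) (hmem n v hv) (hmem n u' hu') (hmem n v' hv') hA hA'
      simp only [← Function.iterate_succ_apply' f] at h2
      have hB' : f^[n + 1] u' < f^[n + 1] v' := hit _ (hsub hu') (hsub hv') huv'
      have hB : f^[n + 1] u < f^[n + 1] v := hit _ (hsub hu) (hsub hv) huv
      have hexp : Real.exp (L * (p - f^[n + 1] p)) =
          Real.exp (L * (f^[n] p - f^[n + 1] p)) * Real.exp (L * (p - f^[n] p)) := by
        rw [← Real.exp_add]; congr 1; ring
      rw [hexp]
      set E := Real.exp (L * (f^[n] p - f^[n + 1] p))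
      set E' := Real.exp (L * (p - f^[n] p))
      have hE : 0 < E := Real.exp_pos _
      have hE' : 0 < E' := Real.exp_pos _
      -- multiply by the positive quantity `f^n v' - f^n u'`
      refine le_of_mul_le_mul_right ?_ (sub_pos.2 hA')
      have h3 := mul_le_mul_of_nonneg_right h2 (sub_pos.2 huv').le
      have h4 := mul_le_mul_of_nonneg_left h1 (mul_nonneg hE.le (sub_pos.2 hB').le)
      linarith
  refine ⟨Real.exp (L * p), Real.exp_pos _, ?_⟩
  intro n u v u' v' hu hv hu' hv' huv huv'
  refine (main n u v u' v' hu hv hu' hv' huv huv').trans ?_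
  have hB' : f^[n] u' < f^[n] v' := hit _ (hsub hu') (hsub hv') huv'
  refine mul_le_mul_of_nonneg_right ?_ (mul_nonneg (sub_pos.2 hB').le (sub_pos.2 huv).le)
  refine Real.exp_le_exp.2 (mul_le_mul_of_nonneg_left ?_ hL0)
  have := (hpn n).1
  linarith

lemma kop_comm_iter (f g : ℝ → ℝ)
    (hf_maps : MapsTo f (Ico (0 : ℝ) 1) (Ico (0 : ℝ) 1))
    (hcomm : ∀ x ∈ Ico (0 : ℝ) 1, f (g x) = g (f x)) (n : ℕ) :
    ∀ x ∈ Ico (0 : ℝ) 1, f^[n] (g x) = g (f^[n] x) := by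
  induction n with
  | zero => intro x _; rfl
  | succ n ih =>
    intro x hx
    rw [Function.iterate_succ_apply, Function.iterate_succ_apply, hcomm x hx,
      ih _ (hf_maps hx)]

lemma kop_core (f g : ℝ → ℝ)
    (hf_maps : MapsTo f (Ico (0 : ℝ) 1) (Ico (0 : ℝ) 1))
    (hg_maps : MapsTo g (Ico (0 : ℝ) 1) (Ico (0 : ℝ) 1))
    (hf0 : f 0 = 0) (hg0 : g 0 = 0)
    (hf_C2 : ContDiffOn ℝ 2 f (Ico (0 : ℝ) 1))
    (hf_deriv : ∀ x ∈ Ico (0 : ℝ) 1, 0 < derivWithin f (Ico (0 : ℝ) 1) x)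
    (hg_C1 : ContDiffOn ℝ 1 g (Ico (0 : ℝ) 1))
    (hg_deriv : ∀ x ∈ Ico (0 : ℝ) 1, 0 < derivWithin g (Ico (0 : ℝ) 1) x)
    (hcomm : ∀ x ∈ Ico (0 : ℝ) 1, f (g x) = g (f x))
    (hcontract : ∀ x ∈ Ioo (0 : ℝ) 1, f x < x)
    {p : ℝ} (hp : p ∈ Ioo (0 : ℝ) 1) (hgp : g p = p) :
    ∀ x ∈ Icc (f p) p, g x = x := by
  have hpI : p ∈ Ico (0 : ℝ) 1 := ⟨hp.1.le, hp.2⟩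
  have hfm := kop_mono f (hf_C2.of_le (by norm_num)) hf_deriv
  have hgm := kop_mono g hg_C1 hg_deriv
  have h0I : (0 : ℝ) ∈ Ico (0 : ℝ) 1 := ⟨le_rfl, one_pos⟩
  have hpn : ∀ n, f^[n] p ∈ Ico (0 : ℝ) 1 := fun n => hf_maps.iterate n hpI
  have hpos : ∀ n, 0 < f^[n] p := by
    intro n
    induction n with
    | zero => exact hp.1
    | succ n ih =>
      rw [Function.iterate_succ_apply']
      have := hfm h0I (hpn n) ih
      rwa [hf0] at this
  have hlim := kop_orbit f hf_maps hf0 hf_C2.continuousOn hcontract hpI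
  have hgpn : ∀ n, g (f^[n] p) = f^[n] p := fun n => by
    rw [← kop_comm_iter f g hf_maps hcomm n p hpI, hgp]
  have hsub : Icc (f p) p ⊆ Ico (0 : ℝ) 1 :=
    fun y hy => ⟨(hf_maps hpI).1.trans hy.1, hy.2.trans_lt hp.2⟩
  -- derivative of g at 0 is 1
  have hg1 : derivWithin g (Ico (0 : ℝ) 1) 0 = 1 := by
    have h := ((hg_C1.differentiableOn (by norm_num)) 0 h0I).hasDerivWithinAt
    rw [hasDerivWithinAt_iff_tendsto_slope] at h
    have h2 : Tendsto (fun n => f^[n] p) atTop (𝓝[Ico (0 : ℝ) 1 \ {0}] 0) :=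
      tendsto_nhdsWithin_iff.2 ⟨hlim, Eventually.of_forall
        (fun n => ⟨hpn n, (hpos n).ne'⟩)⟩
    have h3 := h.comp h2
    refine tendsto_nhds_unique h3 ?_
    refine tendsto_const_nhds.congr (fun n => ?_)
    have := (hpos n).ne'
    simp only [Function.comp, slope_def_field, hgpn, hg0]
    rw [div_self]; simpa using this
  obtain ⟨C, hC, hdist⟩ := kop_distortion f hf_maps hf_C2 hf_deriv hcontract hp
  have hgIcc : ∀ k, ∀ u ∈ Icc (f p) p, g^[k] u ∈ Icc (f p) p := by
    intro k
    have : MapsTo g (Icc (f p) p) (Icc (f p) p) := by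
      intro u hu
      have h1 := hgm.monotoneOn (hf_maps hpI) (hsub hu) hu.1
      have h2 := hgm.monotoneOn (hsub hu) hpI hu.2
      rw [hgp] at h2
      have := hgpn 1
      simp only [Function.iterate_one] at this
      rw [this] at h1
      exact ⟨h1, h2⟩
    exact fun u hu => this.iterate k hu
  have hfit : ∀ n, StrictMonoOn f^[n] (Ico (0 : ℝ) 1) := by
    intro n
    induction n with
    | zero => exact strictMonoOn_id
    | succ n ih =>
      rw [Function.iterate_succ]
      exact ih.comp hfm hf_maps
  have hgit : ∀ n, StrictMonoOn g^[n] (Ico (0 : ℝ) 1) := by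
    intro n
    induction n with
    | zero => exact strictMonoOn_id
    | succ n ih =>
      rw [Function.iterate_succ]
      exact ih.comp hgm hg_maps
  -- near zero the iterates of g hardly contract
  have hnear : ∀ ε : ℝ, 0 < ε → ε < 1 → ∃ n, ∀ k, ∀ s t : ℝ, s ∈ Icc 0 (f^[n] p) →
      t ∈ Icc 0 (f^[n] p) → s < t → (1 - ε) ^ k * (t - s) ≤ g^[k] t - g^[k] s := by
    intro ε hε hε1
    have hcont := (hg_C1.continuousOn_derivWithin (uniqueDiffOn_Ico 0 1) (by norm_num)) 0 h0I
    have hev : ∀ᶠ x in 𝓝[Ico (0 : ℝ) 1] 0, 1 - ε < derivWithin g (Ico (0 : ℝ) 1) x := by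
      apply hcont.eventually (lt_mem_nhds _)
      rw [hg1]; linarith
    obtain ⟨δ, hδ, hball⟩ := Metric.mem_nhdsWithin_iff.1 hev
    obtain ⟨n, hn⟩ := (hlim.eventually (gt_mem_nhds hδ)).exists
    refine ⟨n, ?_⟩
    intro k
    induction k with
    | zero => intro s t _ _ _; simp
    | succ k ih =>
      intro s t hs ht hst
      have hsI : s ∈ Ico (0 : ℝ) 1 := ⟨hs.1, hs.2.trans_lt (hpn n).2⟩
      have htI : t ∈ Ico (0 : ℝ) 1 := ⟨ht.1, ht.2.trans_lt (hpn n).2⟩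
      have hg' : ∀ y ∈ Icc 0 (f^[n] p), g y ∈ Icc 0 (f^[n] p) := by
        intro y hy
        have hyI : y ∈ Ico (0 : ℝ) 1 := ⟨hy.1, hy.2.trans_lt (hpn n).2⟩
        refine ⟨(hg_maps hyI).1, ?_⟩
        have := hgm.monotoneOn hyI (hpn n) hy.2
        rwa [hgpn] at this
      have h1 := ih (g s) (g t) (hg' s hs) (hg' t ht) (hgm hsI htI hst)
      rw [Function.iterate_succ_apply, Function.iterate_succ_apply]
      refine le_trans ?_ h1
      obtain ⟨ξ, hξ, h⟩ := kop_mvt g hg_C1 hs.1 hst htI.2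
      have hξ0 : 0 ≤ ξ := hs.1.trans hξ.1.le
      have hξd : 1 - ε < derivWithin g (Ico (0 : ℝ) 1) ξ := by
        apply hball
        refine ⟨?_, hξ0, hξ.2.trans htI.2⟩
        rw [Metric.mem_ball, Real.dist_eq, sub_zero, abs_of_nonneg hξ0]
        linarith [hξ.2, ht.2]
      rw [h, pow_succ, mul_assoc]
      refine mul_le_mul_of_nonneg_left ?_ (pow_nonneg (by linarith) _)
      exact mul_le_mul_of_nonneg_right hξd.le (by linarith)
  have hlower : ∀ k, ∀ u v : ℝ, u ∈ Icc (f p) p → v ∈ Icc (f p) p → u < v →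
      (v - u) ≤ C * (g^[k] v - g^[k] u) := by
    intro k u v hu hv huv
    have heps : ∀ ε : ℝ, 0 < ε → ε < 1 → (1 - ε) ^ k * (v - u) ≤ C * (g^[k] v - g^[k] u) := by
      intro ε hε hε1
      obtain ⟨n, hn⟩ := hnear ε hε hε1
      have hle : ∀ y ∈ Icc (f p) p, f^[n] y ∈ Icc 0 (f^[n] p) := fun y hy =>
        ⟨(hf_maps.iterate n (hsub hy)).1, (hfit n).monotoneOn (hsub hy) hpI hy.2⟩
      have hA : f^[n] u < f^[n] v := hfit n (hsub hu) (hsub hv) huv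
      have h1 := hn k _ _ (hle u hu) (hle v hv) hA
      have hck : ∀ y ∈ Ico (0 : ℝ) 1, g^[k] (f^[n] y) = f^[n] (g^[k] y) :=
        kop_comm_iter g f^[n] hg_maps
          (fun x hx => (kop_comm_iter f g hf_maps hcomm n x hx).symm) k
      rw [hck u (hsub hu), hck v (hsub hv)] at h1
      have h2 := hdist n _ _ u v (hgIcc k u hu) (hgIcc k v hv) hu hv
        (hgit k (hsub hu) (hsub hv) huv) huv
      refine le_of_mul_le_mul_right ?_ (sub_pos.2 hA)
      have h3 := mul_le_mul_of_nonneg_right h1 (sub_pos.2 huv).le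
      linarith
    have ht : Tendsto (fun ε : ℝ => (1 - ε) ^ k * (v - u)) (𝓝[>] 0) (𝓝 ((1 - 0) ^ k * (v - u))) := by
      apply Tendsto.mono_left _ nhdsWithin_le_nhds
      apply Continuous.tendsto
      fun_prop
    have := le_of_tendsto ht (by
      filter_upwards [Ioo_mem_nhdsGT (one_pos : (0 : ℝ) < 1)] with ε hε
      exact heps ε hε.1 hε.2)
    simpa using this
  intro x hx
  by_contra hne
  -- the orbit of x under g converges
  have hconv : ∃ l, Tendsto (fun k => g^[k] x) atTop (𝓝 l) := by
    have hgx : g x ∈ Icc (f p) p := hgIcc 1 x hx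
    rcases lt_or_gt_of_ne hne with h | h
    · have hanti : Antitone (fun k => g^[k] x) := antitone_nat_of_succ_le (fun k => by
        rw [Function.iterate_succ_apply]
        exact (hgit k (hsub hgx) (hsub hx) h).le)
      exact ⟨_, tendsto_atTop_ciInf hanti ⟨f p, by rintro _ ⟨n, rfl⟩; exact (hgIcc n x hx).1⟩⟩
    · have hmon : Monotone (fun k => g^[k] x) := monotone_nat_of_le_succ (fun k => by
        rw [Function.iterate_succ_apply]
        exact (hgit k (hsub hx) (hsub hgx) h).le)
      exact ⟨_, tendsto_atTop_ciSup hmon ⟨p, by rintro _ ⟨n, rfl⟩; exact (hgIcc n x hx).2⟩⟩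
  obtain ⟨l, hl⟩ := hconv
  have hl' := (tendsto_add_atTop_iff_nat 1).2 hl
  have hgx : g x ∈ Icc (f p) p := hgIcc 1 x hx
  rcases lt_or_gt_of_ne hne with h | h
  · have ht := (hl.sub hl').const_mul C
    have := ge_of_tendsto' ht (fun k => hlower k _ _ hgx hx h)
    simp at this
    linarith
  · have ht := (hl'.sub hl).const_mul C
    have := ge_of_tendsto' ht (fun k => hlower k _ _ hx hgx h)
    simp at this
    linarith

/-- **Kopell's Lemma.** Let `f` and `g` be commuting diffeomorphisms mapping `[0,1)` into
itself, fixing the origin, of class `C²` resp. `C¹` on `[0,1)` with everywhere strictly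
positive derivative there, and assume `f` is contracting. Then either `g` has no fixed
point in `(0,1)` or `g` is the identity on `[0,1)`. -/
theorem kopell_lemma (f g : ℝ → ℝ)
    (hf_maps : MapsTo f (Ico (0 : ℝ) 1) (Ico (0 : ℝ) 1))
    (hg_maps : MapsTo g (Ico (0 : ℝ) 1) (Ico (0 : ℝ) 1))
    (hf0 : f 0 = 0) (hg0 : g 0 = 0)
    (hf_C2 : ContDiffOn ℝ 2 f (Ico (0 : ℝ) 1))
    (hf_deriv : ∀ x ∈ Ico (0 : ℝ) 1, 0 < derivWithin f (Ico (0 : ℝ) 1) x)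
    (hg_C1 : ContDiffOn ℝ 1 g (Ico (0 : ℝ) 1))
    (hg_deriv : ∀ x ∈ Ico (0 : ℝ) 1, 0 < derivWithin g (Ico (0 : ℝ) 1) x)
    (hcomm : ∀ x ∈ Ico (0 : ℝ) 1, f (g x) = g (f x))
    (hcontract : ∀ x ∈ Ioo (0 : ℝ) 1, f x < x) :
    (∀ x ∈ Ioo (0 : ℝ) 1, g x ≠ x) ∨ (∀ x ∈ Ico (0 : ℝ) 1, g x = x) := by
  by_cases hfix : ∀ x ∈ Ioo (0 : ℝ) 1, g x ≠ x
  · exact Or.inl hfix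
  right
  push Not at hfix
  obtain ⟨p, hp, hgp⟩ := hfix
  have hpI : p ∈ Ico (0 : ℝ) 1 := ⟨hp.1.le, hp.2⟩
  have h0I : (0 : ℝ) ∈ Ico (0 : ℝ) 1 := ⟨le_rfl, one_pos⟩
  have hfm := kop_mono f (hf_C2.of_le (by norm_num)) hf_deriv
  have hlim := kop_orbit f hf_maps hf0 hf_C2.continuousOn hcontract hpI
  have hpn : ∀ n, f^[n] p ∈ Ioo (0 : ℝ) 1 := by
    intro n
    induction n with
    | zero => exact hp
    | succ n ih =>
      rw [Function.iterate_succ_apply']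
      have := hfm h0I ⟨ih.1.le, ih.2⟩ ih.1
      rw [hf0] at this
      exact ⟨this, (hcontract _ ih).trans ih.2⟩
  have hgpn : ∀ n, g (f^[n] p) = f^[n] p := fun n => by
    rw [← kop_comm_iter f g hf_maps hcomm n p hpI, hgp]
  have hsmall : ∀ x ∈ Ioc (0 : ℝ) p, g x = x := by
    intro x hx
    have hex : ∃ n, f^[n] p < x := (hlim.eventually (gt_mem_nhds hx.1)).exists
    classical
    have hspec := Nat.find_spec hex
    have hmin := fun m => @Nat.find_min _ _ hex m
    cases hN : Nat.find hex with
    | zero =>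
      rw [hN] at hspec
      exact absurd hspec (not_lt.2 hx.2)
    | succ m =>
      rw [hN] at hspec hmin
      have h1 := hmin m (Nat.lt_succ_self m)
      rw [Function.iterate_succ_apply'] at hspec
      exact kop_core f g hf_maps hg_maps hf0 hg0 hf_C2 hf_deriv hg_C1 hg_deriv hcomm hcontract
        (hpn m) (hgpn m) x ⟨hspec.le, not_lt.1 h1⟩
  have hfit : ∀ n, StrictMonoOn f^[n] (Ico (0 : ℝ) 1) := by
    intro n
    induction n with
    | zero => exact strictMonoOn_id
    | succ n ih =>
      rw [Function.iterate_succ]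
      exact ih.comp hfm hf_maps
  intro x hx
  have hlx := kop_orbit f hf_maps hf0 hf_C2.continuousOn hcontract hx
  obtain ⟨n, hn⟩ := (hlx.eventually (gt_mem_nhds hp.1)).exists
  have hmem := hf_maps.iterate n hx
  have h1 : g (f^[n] x) = f^[n] x := by
    rcases hmem.1.eq_or_lt with h | h
    · rw [← h, hg0]
    · exact hsmall _ ⟨h, hn.le⟩
  rw [← kop_comm_iter f g hf_maps hcomm n x hx] at h1
  exact (hfit n).injOn (hg_maps hx) hx h1
end

section
/- (Matsumoto's conjugacy criterion for circle actions.) Let Γ be a group and S ⊆ Γ a set generating Γ. For i = 1, 2 let ρ̃ᵢ : Γ → G be maps into the group G of invertible degree-one lifts of the circle (monotone bijections F of ℝ with F(x+1) = F(x)+1 whose inverse is also such a map), and assume each ρ̃ᵢ is a lift of a circle action: for all g, h ∈ Γ there is an integer m with ρ̃ᵢ(g·h) = T_m ∘ ρ̃ᵢ(g) ∘ ρ̃ᵢ(h), where T_m denotes translation by m. Assume moreover: (a) for all g₁, g₂ ∈ Γ, τ(ρ̃₁(g₁) ∘ ρ̃₁(g₂)) − τ(ρ̃₁(g₁)) − τ(ρ̃₁(g₂))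 = τ(ρ̃₂(g₁) ∘ ρ̃₂(g₂)) − τ(ρ̃₂(g₁)) − τ(ρ̃₂(g₂)), where τ denotes the translation number; (b) for every s ∈ S, the difference τ(ρ̃₁(s)) − τ(ρ̃₂(s)) is an integer; (c) both induced circle actions are minimal, i.e. for i = 1, 2 and every x ∈ ℝ, the set { ρ̃ᵢ(g)(x) + m : g ∈ Γ, m ∈ ℤ } is dense in ℝ. Then the two actions are topologically conjugate by an orientation-preserving homeomorphism of the circle: there exists an invertible degree-one lift H ∈ G such that for every g ∈ Γ there is an integer m(g) with H ∘ ρ̃₁(g) ∘ H⁻¹ = T_{m(g)} ∘ ρ̃₂(g). -/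
open CircleDeg1Lift

namespace MatsumotoAux

noncomputable abbrev T (m : ℤ) : CircleDeg1Liftˣ := translate (Multiplicative.ofAdd (m : ℝ))

lemma T_add (m n : ℤ) : T (m + n) = T m * T n := by
  simp [T, ofAdd_add]

lemma T_zero : T 0 = 1 := by simp [T]

lemma T_neg (m : ℤ) : T (-m) = (T m)⁻¹ := by
  rw [eq_inv_iff_mul_eq_one, ← T_add]; simp [T_zero]

lemma T_comm (m : ℤ) (a : CircleDeg1Liftˣ) : a * T m = T m * a := by
  ext x
  simp [T]

lemma tau_T (m : ℤ) (a : CircleDeg1Liftˣ) :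
    ((T m * a : CircleDeg1Liftˣ) : CircleDeg1Lift).translationNumber
      = m + (a : CircleDeg1Lift).translationNumber := by
  have h : Commute ((T m : CircleDeg1Liftˣ) : CircleDeg1Lift) (a : CircleDeg1Lift) := by
    have := congrArg Units.val (T_comm m a)
    exact this.symm
  rw [Units.val_mul, translationNumber_mul_of_commute h, translationNumber_translate]

lemma T_mul_mul (m n : ℤ) (a b : CircleDeg1Liftˣ) :
    (T m * a) * (T n * b) = T (m + n) * (a * b) := by
  rw [T_add, mul_assoc, ← mul_assoc a, T_comm n a]; simp only [mul_assoc]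

section
variable {Γ : Type*} [Group Γ] (ρ₁ ρ₂ : Γ → CircleDeg1Liftˣ)

def Lft (ρ : Γ → CircleDeg1Liftˣ) (g : Γ) (a : CircleDeg1Liftˣ) : Prop := ∃ m : ℤ, a = T m * ρ g

lemma Lft.mul {ρ : Γ → CircleDeg1Liftˣ} (hl : ∀ g h : Γ, ∃ m : ℤ, ρ (g * h) = T m * ρ g * ρ h)
    {g h a b} (ha : Lft ρ g a) (hb : Lft ρ h b) : Lft ρ (g * h) (a * b) := by
  obtain ⟨m, rfl⟩ := ha
  obtain ⟨n, rfl⟩ := hb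
  obtain ⟨k, hk⟩ := hl g h
  refine ⟨m + n - k, ?_⟩
  rw [hk, T_mul_mul, ← mul_assoc (T (m + n - k)), ← mul_assoc (T (m + n - k)), ← T_add,
    mul_assoc]
  simp

lemma Lft.one {ρ : Γ → CircleDeg1Liftˣ} (hl : ∀ g h : Γ, ∃ m : ℤ, ρ (g * h) = T m * ρ g * ρ h) :
    Lft ρ 1 1 := by
  obtain ⟨k, hk⟩ := hl 1 1
  refine ⟨k, ?_⟩
  rw [mul_one] at hk
  exact (mul_eq_right.mp hk.symm).symm

lemma Lft.inv {ρ : Γ → CircleDeg1Liftˣ} (hl : ∀ g h : Γ, ∃ m : ℤ, ρ (g * h) = T m * ρ g * ρ h)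
    {g a} (ha : Lft ρ g a) : Lft ρ g⁻¹ a⁻¹ := by
  have h1 : Lft ρ (g * g⁻¹) (a * ρ g⁻¹) := ha.mul hl ⟨0, by simp [T_zero]⟩
  rw [mul_inv_cancel] at h1
  obtain ⟨k, hk⟩ := h1
  obtain ⟨l, hl'⟩ := Lft.one hl
  refine ⟨l - k, ?_⟩
  have : ρ 1 = T (-l) := by rw [T_neg, eq_inv_iff_mul_eq_one, T_comm, ← hl']
  rw [this, ← T_add] at hk
  rw [inv_eq_iff_mul_eq_one, ← mul_assoc, T_comm, mul_assoc, hk, ← T_add,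
    show l - k + (k + -l) = 0 by ring, T_zero]

/-- compatible pairs of lifts -/
def P (g : Γ) (a b : CircleDeg1Liftˣ) : Prop :=
  Lft ρ₁ g a ∧ Lft ρ₂ g b ∧
    (a : CircleDeg1Lift).translationNumber = (b : CircleDeg1Lift).translationNumber

end

/-- A semiconjugacy between minimal actions is bijective. -/
lemma bijective_of_minimal {ι : Type*} (a b : ι → CircleDeg1Liftˣ) (F : CircleDeg1Lift)
    (hF : ∀ i x, F (a i x) = b i (F x))
    (h1 : ∀ x : ℝ, Dense {y : ℝ | ∃ (i : ι) (m : ℤ), y = a i x + (m : ℝ)})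
    (h2 : ∀ x : ℝ, Dense {y : ℝ | ∃ (i : ι) (m : ℤ), y = b i x + (m : ℝ)}) :
    Function.Bijective F := by
  constructor
  · by_contra hinj
    have hcont : ∀ i, Continuous (a i : ℝ → ℝ) := fun i => by
      rw [← coe_toOrderIso]; exact (toOrderIso (a i)).continuous
    obtain ⟨x, y, hxy, hne⟩ : ∃ x y, x < y ∧ F x = F y := by
      simp only [Function.Injective, not_forall] at hinj
      obtain ⟨x, y, h, hne⟩ := hinj
      rcases lt_or_gt_of_ne hne with h' | h'
      · exact ⟨x, y, h', h⟩
      · exact ⟨y, x, h', h.symm⟩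
    have hc : ∀ z ∈ Set.Ioo x y, F z = F x := fun z hz =>
      le_antisymm ((F.mono hz.2.le).trans hne.ge) (F.mono hz.1.le)
    have hloc : IsLocallyConstant F := by
      rw [IsLocallyConstant.iff_eventually_eq]
      intro z
      obtain ⟨w, ⟨i, m, rfl⟩, hw⟩ := (h1 z).exists_mem_open isOpen_Ioo (Set.nonempty_Ioo.2 hxy) |>.imp
        fun w h => h
      have hev : ∀ᶠ u in nhds z, a i u + (m : ℝ) ∈ Set.Ioo x y :=
        ((hcont i).add continuous_const).continuousAt.eventually (isOpen_Ioo.mem_nhds hw)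
      filter_upwards [hev] with u hu
      have e := (hc _ hu).trans (hc _ hw).symm
      rw [F.map_add_int, F.map_add_int, hF, hF] at e
      have e' := add_right_cancel e
      rw [← coe_toOrderIso] at e'
      exact (toOrderIso (b i)).injective e'
    have := hloc.apply_eq_of_preconnectedSpace 0 (0 + 1)
    rw [F.map_add_one] at this
    linarith
  · rw [← continuous_iff_surjective]
    apply F.monotone.continuous_of_denseRange
    refine (h2 (F 0)).mono ?_
    rintro _ ⟨i, m, rfl⟩
    exact ⟨a i 0 + m, by rw [F.map_add_int, hF]⟩

end MatsumotoAux

open MatsumotoAux in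


/-- **Matsumoto's conjugacy criterion for circle actions.** Let `Γ` be a group generated
by a set `S`, and for `i = 1, 2` let `ρᵢ : Γ → CircleDeg1Liftˣ` be lifts of circle actions
(products are respected up to integer translations).  If the translation-number defects
`τ(ρᵢ(g₁)ρᵢ(g₂)) - τ(ρᵢ(g₁)) - τ(ρᵢ(g₂))` of the two lifts agree, the rotation numbers agree
on the generating set `S` (i.e. the translation numbers differ by integers there), and both
induced circle actions are minimal, then the actions are conjugate by an orientation
preserving homeomorphism of the circle: there is an invertible degree-one lift `H` with
`H ∘ ρ₁(g) ∘ H⁻¹ = T_{m(g)} ∘ ρ₂(g)` for integers `m(g)`. -/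
theorem matsumoto_conjugacy {Γ : Type*} [Group Γ] (S : Set Γ)
    (hS : Subgroup.closure S = ⊤)
    (ρ₁ ρ₂ : Γ → CircleDeg1Liftˣ)
    (hlift₁ : ∀ g h : Γ, ∃ m : ℤ,
      ρ₁ (g * h) = translate (Multiplicative.ofAdd (m : ℝ)) * ρ₁ g * ρ₁ h)
    (hlift₂ : ∀ g h : Γ, ∃ m : ℤ,
      ρ₂ (g * h) = translate (Multiplicative.ofAdd (m : ℝ)) * ρ₂ g * ρ₂ h)
    (hτ : ∀ g₁ g₂ : Γ,
      ((ρ₁ g₁ * ρ₁ g₂ : CircleDeg1Liftˣ) : CircleDeg1Lift).translationNumber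
          - ((ρ₁ g₁ : CircleDeg1Lift).translationNumber)
          - ((ρ₁ g₂ : CircleDeg1Lift).translationNumber)
        = ((ρ₂ g₁ * ρ₂ g₂ : CircleDeg1Liftˣ) : CircleDeg1Lift).translationNumber
          - ((ρ₂ g₁ : CircleDeg1Lift).translationNumber)
          - ((ρ₂ g₂ : CircleDeg1Lift).translationNumber))
    (hrot : ∀ s ∈ S, ∃ m : ℤ,
      (ρ₁ s : CircleDeg1Lift).translationNumber
        - (ρ₂ s : CircleDeg1Lift).translationNumber = (m : ℝ))
    (hmin₁ : ∀ x : ℝ,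
      Dense {y : ℝ | ∃ (g : Γ) (m : ℤ), y = (ρ₁ g : CircleDeg1Lift) x + (m : ℝ)})
    (hmin₂ : ∀ x : ℝ,
      Dense {y : ℝ | ∃ (g : Γ) (m : ℤ), y = (ρ₂ g : CircleDeg1Lift) x + (m : ℝ)}) :
    ∃ H : CircleDeg1Liftˣ, ∀ g : Γ, ∃ m : ℤ,
      H * ρ₁ g * H⁻¹ = translate (Multiplicative.ofAdd (m : ℝ)) * ρ₂ g := by

  have Pmul : ∀ g h a b a' b', P ρ₁ ρ₂ g a b → P ρ₁ ρ₂ h a' b' →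
      P ρ₁ ρ₂ (g * h) (a * a') (b * b') := by
    rintro g h a b a' b' ⟨ha, hb, e⟩ ⟨ha', hb', e'⟩
    refine ⟨ha.mul hlift₁ ha', hb.mul hlift₂ hb', ?_⟩
    obtain ⟨m, rfl⟩ := ha
    obtain ⟨n, rfl⟩ := hb
    obtain ⟨m', rfl⟩ := ha'
    obtain ⟨n', rfl⟩ := hb'
    rw [T_mul_mul, T_mul_mul, tau_T, tau_T]
    rw [tau_T, tau_T] at e e'
    have := hτ g h
    push_cast at *
    linarith
  have Pone : P ρ₁ ρ₂ 1 1 1 := ⟨Lft.one hlift₁, Lft.one hlift₂, rfl⟩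
  have Pinv : ∀ g a b, P ρ₁ ρ₂ g a b → P ρ₁ ρ₂ g⁻¹ a⁻¹ b⁻¹ := by
    rintro g a b ⟨ha, hb, e⟩
    refine ⟨ha.inv hlift₁, hb.inv hlift₂, ?_⟩
    rw [translationNumber_units_inv, translationNumber_units_inv, e]
  have exP : ∀ g, ∃ a b, P ρ₁ ρ₂ g a b := by
    intro g
    have hg : g ∈ Subgroup.closure S := hS ▸ Subgroup.mem_top g
    induction hg using Subgroup.closure_induction with
    | mem s hs =>
      obtain ⟨m, hm⟩ := hrot s hs
      refine ⟨ρ₁ s, T m * ρ₂ s, ⟨0, by rw [T_zero, one_mul]⟩, ⟨m, rfl⟩, ?_⟩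
      rw [tau_T]
      linarith
    | one => exact ⟨1, 1, Pone⟩
    | mul x y _ _ hx hy =>
      obtain ⟨a, b, h⟩ := hx
      obtain ⟨a', b', h'⟩ := hy
      exact ⟨_, _, Pmul _ _ _ _ _ _ h h'⟩
    | inv x _ hx =>
      obtain ⟨a, b, h⟩ := hx
      exact ⟨_, _, Pinv _ _ _ h⟩
  let G : Subgroup (CircleDeg1Liftˣ × CircleDeg1Liftˣ) :=
    { carrier := {p | ∃ g, P ρ₁ ρ₂ g p.1 p.2}
      mul_mem' := by
        rintro p q ⟨g, hg⟩ ⟨h, hh⟩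
        exact ⟨g * h, Pmul _ _ _ _ _ _ hg hh⟩
      one_mem' := ⟨1, Pone⟩
      inv_mem' := by
        rintro p ⟨g, hg⟩
        exact ⟨g⁻¹, Pinv _ _ _ hg⟩ }
  obtain ⟨F, hF⟩ := semiconj_of_group_action_of_forall_translationNumber_eq
    ((Units.coeHom CircleDeg1Lift).comp ((MonoidHom.fst _ _).comp G.subtype))
    ((Units.coeHom CircleDeg1Lift).comp ((MonoidHom.snd _ _).comp G.subtype))
    (by rintro ⟨p, g, hg⟩; exact hg.2.2)
  choose a b hab using exP
  have hF' : ∀ g x, F (a g x) = b g (F x) := fun g x => hF ⟨(a g, b g), g, hab g⟩ x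
  have hbij : Function.Bijective F := by
    apply bijective_of_minimal a b F hF'
    · intro x
      refine (hmin₁ x).mono ?_
      rintro _ ⟨g, m, rfl⟩
      obtain ⟨k, hk⟩ := (hab g).1
      refine ⟨g, m - k, ?_⟩
      rw [hk]
      simp only [T, Units.val_mul, mul_apply, translate_apply]
      push_cast
      ring
    · intro x
      refine (hmin₂ x).mono ?_
      rintro _ ⟨g, m, rfl⟩
      obtain ⟨k, hk⟩ := (hab g).2.1
      refine ⟨g, m - k, ?_⟩
      rw [hk]
      simp only [T, Units.val_mul, mul_apply, translate_apply]
      push_cast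
      ring
  obtain ⟨H, rfl⟩ := isUnit_iff_bijective.2 hbij
  refine ⟨H, fun g => ?_⟩
  obtain ⟨k, hk⟩ := (hab g).1
  obtain ⟨l, hl⟩ := (hab g).2.1
  refine ⟨l - k, ?_⟩
  have key : H * a g = b g * H := by
    ext x
    exact hF' g x
  change _ = T (l - k) * ρ₂ g
  rw [hk, hl, ← mul_assoc, T_comm, mul_assoc] at key
  rw [mul_inv_eq_iff_eq_mul, sub_eq_neg_add, T_add, T_neg, mul_assoc, mul_assoc,
    eq_inv_mul_iff_mul_eq, key, mul_assoc]
end
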